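/- Let p be a log-concave probability density on ℝ^d with mean μ and covariance matrix Σ, let A ∈ ℝ^{d×d} be positive definite, and set Q = A^{−1/2} Σ A^{−1/2}. Then for every integer q ≥ 1, ‖ ∫ A^{−1/2}(x−μ) · [ (x−μ)ᵀ A^{−1/2} Q^{q−1} A^{−1/2} (x−μ) ] p(x) dx ‖₂ ≤ 16 · ( tr(Q^q) )^{1 + 1/(2q)}. -/

import Mathlib

open MeasureTheory Filter Matrix

noncomputable section

/-- Mass of a set under a density. -/
def setMass {d : ℕ} (p : EuclideanSpace ℝ (Fin d) → ℝ) (S : Set (EuclideanSpace ℝ (Fin d))) : ℝ :=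
  ∫ x in S, p x

/-- `p` is a log-concave probability density on `ℝ^d`. -/
def IsLogConcaveDensity {d : ℕ} (p : EuclideanSpace ℝ (Fin d) → ℝ) : Prop :=
  (∀ x, 0 ≤ p x) ∧ (∫ x, p x = 1) ∧
    ∀ x y : EuclideanSpace ℝ (Fin d), ∀ t : ℝ, t ∈ Set.Icc (0:ℝ) 1 →
      p (t • x + (1 - t) • y) ≥ p x ^ t * p y ^ (1 - t)

/-- Boundary measure `p⁺(∂S)`. -/
def boundaryMeasure {d : ℕ} (p : EuclideanSpace ℝ (Fin d) → ℝ)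
    (S : Set (EuclideanSpace ℝ (Fin d))) : ℝ :=
  Filter.liminf
    (fun ε : ℝ => (setMass p {x | Metric.infDist x S ≤ ε} - setMass p S) / ε)
    (nhdsWithin 0 (Set.Ioi 0))

/-- Isoperimetric coefficient. -/
def isoperiCoeff {d : ℕ} (p : EuclideanSpace ℝ (Fin d) → ℝ) : ℝ :=
  sInf { r | ∃ S : Set (EuclideanSpace ℝ (Fin d)), MeasurableSet S ∧
    0 < setMass p S ∧ setMass p S < 1 ∧
    r = boundaryMeasure p S / min (setMass p S) (setMass p Sᶜ) }

/-- Mean of a density. -/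
def densMean {d : ℕ} (p : EuclideanSpace ℝ (Fin d) → ℝ) : EuclideanSpace ℝ (Fin d) :=
  ∫ x, p x • x

/-- Covariance matrix of a density. -/
def covMatrix {d : ℕ} (p : EuclideanSpace ℝ (Fin d) → ℝ) : Matrix (Fin d) (Fin d) ℝ :=
  Matrix.of fun i j => ∫ x, p x * ((x i - densMean p i) * (x j - densMean p j))

/-- Spectral norm of a matrix. -/
def specNorm {d : ℕ} (A : Matrix (Fin d) (Fin d) ℝ) : ℝ :=
  ‖Matrix.toEuclideanCLM (𝕜 := ℝ) A‖

/-- The KLS infimum constant over dimension `k`. -/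
def psiDim (k : ℕ) : ℝ :=
  sInf { r | ∃ p : EuclideanSpace ℝ (Fin k) → ℝ, IsLogConcaveDensity p ∧
    HasCompactSupport p ∧ r = isoperiCoeff p * Real.sqrt (specNorm (covMatrix p)) }

/-- Real power of a symmetric matrix through its spectral decomposition. -/
def matRpow {d : ℕ} (A : Matrix (Fin d) (Fin d) ℝ) (r : ℝ) : Matrix (Fin d) (Fin d) ℝ :=
  if hA : A.IsHermitian then
    (hA.eigenvectorUnitary : Matrix (Fin d) (Fin d) ℝ) *
      Matrix.diagonal (fun i => hA.eigenvalues i ^ r) *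
      (star (hA.eigenvectorUnitary : Matrix (Fin d) (Fin d) ℝ))
  else 0

/-- The 3-tensor `T_p(A,B,C)` of a density. -/
def ttensor {d : ℕ} (p : EuclideanSpace ℝ (Fin d) → ℝ)
    (A B C : Matrix (Fin d) (Fin d) ℝ) : ℝ :=
  ∫ x : EuclideanSpace ℝ (Fin d), ∫ y : EuclideanSpace ℝ (Fin d),
    p x * p y *
      (((fun i => x i - densMean p i) ⬝ᵥ A.mulVec (fun i => y i - densMean p i)) *
       ((fun i => x i - densMean p i) ⬝ᵥ B.mulVec (fun i => y i - densMean p i)) *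
       ((fun i => x i - densMean p i) ⬝ᵥ C.mulVec (fun i => y i - densMean p i)))

/-- `p` is more log-concave than `N(0, τ⁻¹ I_d)`. -/
def IsMoreLogConcaveThanGauss {d : ℕ} (τ : ℝ) (p : EuclideanSpace ℝ (Fin d) → ℝ) : Prop :=
  (∀ x, 0 ≤ p x) ∧ (∫ x, p x = 1) ∧
    ∀ x y : EuclideanSpace ℝ (Fin d), ∀ t : ℝ, t ∈ Set.Icc (0:ℝ) 1 →
      p (t • x + (1 - t) • y) * Real.exp (τ * ‖t • x + (1 - t) • y‖ ^ 2 / 2) ≥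
        (p x * Real.exp (τ * ‖x‖ ^ 2 / 2)) ^ t *
        (p y * Real.exp (τ * ‖y‖ ^ 2 / 2)) ^ (1 - t)

end

open scoped ENNReal NNReal

/-! ### Log-concave functions and the Prékopa–Leindler inequality -/

/-- Log-concavity of an extended nonnegative function on a real vector space. -/
def LogConcaveFun {E : Type*} [AddCommGroup E] [Module ℝ E] (F : E → ℝ≥0∞) : Prop :=
  ∀ x y : E, ∀ a b : ℝ, 0 < a → 0 < b → a + b = 1 → F x ^ a * F y ^ b ≤ F (a • x + b • y)

theorem LogConcaveFun.convex_superlevel {E : Type*} [AddCommGroup E] [Module ℝ E]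
    {F : E → ℝ≥0∞} (hF : LogConcaveFun F) (c : ℝ≥0∞) : Convex ℝ {x | c < F x} := by
  rw [convex_iff_forall_pos]
  intro x hx y hy a b ha hb hab
  have hx' : c < F x := hx
  have hy' : c < F y := hy
  have hmin : c < min (F x) (F y) := lt_min hx' hy'
  refine lt_of_lt_of_le hmin (le_trans ?_ (hF x y a b ha hb hab))
  calc min (F x) (F y) = min (F x) (F y) ^ a * min (F x) (F y) ^ b := by
        rw [← ENNReal.rpow_add_of_nonneg a b ha.le hb.le, hab, ENNReal.rpow_one]
    _ ≤ F x ^ a * F y ^ b := by gcongr <;> simp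

theorem LogConcaveFun.ordConnected_superlevel {F : ℝ → ℝ≥0∞} (hF : LogConcaveFun F)
    (c : ℝ≥0∞) : Set.OrdConnected {x | c < F x} :=
  (hF.convex_superlevel c).ordConnected

theorem measurable_of_ordConnected_superlevel {F : ℝ → ℝ≥0∞}
    (hF : ∀ c, Set.OrdConnected {x | c < F x}) : Measurable F :=
  measurable_of_Ioi fun c => (hF c).measurableSet

/-- The one-dimensional Brunn–Minkowski inequality for intervals. -/
theorem volume_add_le_of_combination_mem {I J K : Set ℝ} (hI : I.Nonempty) (hJ : J.Nonempty)
    (hK : K.OrdConnected) {a b : ℝ} (ha : 0 < a) (hb : 0 < b)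
    (h : ∀ x ∈ I, ∀ y ∈ J, a * x + b * y ∈ K) :
    ENNReal.ofReal a * volume I + ENNReal.ofReal b * volume J ≤ volume K := by
  have key : ∀ x ∈ I, ∀ x' ∈ I, ∀ y ∈ J, ∀ y' ∈ J,
      ENNReal.ofReal a * edist x x' + ENNReal.ofReal b * edist y y' ≤ volume K := by
    have aux : ∀ x ∈ I, ∀ x' ∈ I, ∀ y ∈ J, ∀ y' ∈ J, x ≤ x' → y ≤ y' →
        ENNReal.ofReal a * edist x x' + ENNReal.ofReal b * edist y y' ≤ volume K := by
      intro x hx x' hx' y hy y' hy' hxx hyy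
      have hsub := hK.out (h x hx y hy) (h x' hx' y' hy')
      refine le_trans (le_of_eq ?_) (measure_mono hsub)
      rw [Real.volume_Icc, edist_comm x, edist_comm y, edist_dist, edist_dist, Real.dist_eq,
        Real.dist_eq, abs_of_nonneg (sub_nonneg.2 hxx), abs_of_nonneg (sub_nonneg.2 hyy),
        ← ENNReal.ofReal_mul ha.le, ← ENNReal.ofReal_mul hb.le, ← ENNReal.ofReal_add]
      · congr 1; ring
      · exact mul_nonneg ha.le (sub_nonneg.2 hxx)
      · exact mul_nonneg hb.le (sub_nonneg.2 hyy)
    intro x hx x' hx' y hy y' hy'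
    rcases le_total x x' with h1 | h1 <;> rcases le_total y y' with h2 | h2
    · exact aux x hx x' hx' y hy y' hy' h1 h2
    · rw [edist_comm y]; exact aux x hx x' hx' y' hy' y hy h1 h2
    · rw [edist_comm x]; exact aux x' hx' x hx y hy y' hy' h1 h2
    · rw [edist_comm x, edist_comm y]; exact aux x' hx' x hx y' hy' y hy h1 h2
  calc ENNReal.ofReal a * volume I + ENNReal.ofReal b * volume J
      ≤ ENNReal.ofReal a * Metric.ediam I + ENNReal.ofReal b * Metric.ediam J := by
        gcongr <;> exact Real.volume_le_diam _
    _ ≤ volume K := by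
        obtain ⟨x₀, hx₀⟩ := hI
        obtain ⟨y₀, hy₀⟩ := hJ
        have : Nonempty I := ⟨⟨x₀, hx₀⟩⟩
        have : Nonempty J := ⟨⟨y₀, hy₀⟩⟩
        have e : ∀ S : Set ℝ, Metric.ediam S = ⨆ p : S × S, edist (p.1 : ℝ) p.2 := by
          intro S
          apply le_antisymm
          · exact Metric.ediam_le fun x hx y hy =>
              le_iSup (fun p : S × S => edist (p.1 : ℝ) p.2) (⟨x, hx⟩, ⟨y, hy⟩)
          · exact iSup_le fun p => Metric.edist_le_ediam_of_mem p.1.2 p.2.2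
        rw [e I, e J, ENNReal.mul_iSup, ENNReal.mul_iSup]
        exact ENNReal.iSup_add_iSup_le fun p r =>
          key p.1 p.1.2 p.2 p.2.2 r.1 r.1.2 r.2 r.2.2

theorem lintegral_eq_lintegral_superlevel {f : ℝ → ℝ≥0∞} (hf : Measurable f)
    (hf1 : ∀ x, f x ≠ ∞) :
    ∫⁻ x, f x = ∫⁻ t : ℝ in Set.Ioi 0, volume {x | ENNReal.ofReal t < f x} := by
  calc ∫⁻ x, f x = ∫⁻ x, ENNReal.ofReal (f x).toReal := by
        simp only [ENNReal.ofReal_toReal (hf1 _)]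
    _ = ∫⁻ t : ℝ in Set.Ioi 0, volume {x | t < (f x).toReal} :=
        lintegral_eq_lintegral_meas_lt _ (ae_of_all _ fun x => ENNReal.toReal_nonneg)
          hf.ennreal_toReal.aemeasurable
    _ = _ := by
        refine setLIntegral_congr_fun measurableSet_Ioi fun t ht => ?_
        congr 1
        ext x
        simp only [Set.mem_ofPred_eq]
        exact (ENNReal.ofReal_lt_iff_lt_toReal (le_of_lt ht) (hf1 x)).symm

theorem ennreal_geom_mean_le_arith_mean {a b : ℝ} (ha : 0 < a) (hb : 0 < b) (hab : a + b = 1)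
    (x y : ℝ≥0∞) : x ^ a * y ^ b ≤ ENNReal.ofReal a * x + ENNReal.ofReal b * y := by
  induction x with
  | top => simp [ENNReal.mul_top, ha]
  | coe x =>
    induction y with
    | top => simp [ENNReal.mul_top, hb]
    | coe y =>
      rw [← ENNReal.coe_rpow_of_nonneg _ ha.le, ← ENNReal.coe_rpow_of_nonneg _ hb.le,
        ENNReal.ofReal, ENNReal.ofReal]
      norm_cast
      have := NNReal.geom_mean_le_arith_mean2_weighted a.toNNReal b.toNNReal x y
        (by rw [← Real.toNNReal_add ha.le hb.le, hab, Real.toNNReal_one])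
      rwa [Real.coe_toNNReal _ ha.le, Real.coe_toNNReal _ hb.le] at this

theorem arith_mean_lintegral_le_of_iSup_eq_one {f g h : ℝ → ℝ≥0∞}
    (hf : Measurable f) (hg : Measurable g)
    (hh : ∀ c, Set.OrdConnected {x | c < h x}) (hf1 : ⨆ x, f x = 1) (hg1 : ⨆ x, g x = 1)
    {a b : ℝ} (ha : 0 < a) (hb : 0 < b) (hab : a + b = 1)
    (H : ∀ x y, f x ^ a * g y ^ b ≤ h (a * x + b * y)) :
    ENNReal.ofReal a * (∫⁻ x, f x) + ENNReal.ofReal b * (∫⁻ x, g x) ≤ ∫⁻ x, h x := by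
  have hhm : Measurable h := measurable_of_ordConnected_superlevel hh
  have hfle : ∀ x, f x ≤ 1 := fun x => hf1 ▸ le_iSup f x
  have hgle : ∀ x, g x ≤ 1 := fun x => hg1 ▸ le_iSup g x
  calc ENNReal.ofReal a * (∫⁻ x, f x) + ENNReal.ofReal b * (∫⁻ x, g x)
      ≤ ∫⁻ x, min (h x) 1 := ?_
    _ ≤ ∫⁻ x, h x := lintegral_mono fun x => min_le_left _ _
  rw [lintegral_eq_lintegral_superlevel hf fun x => ((hfle x).trans_lt ENNReal.one_lt_top).ne,
    lintegral_eq_lintegral_superlevel hg fun x => ((hgle x).trans_lt ENNReal.one_lt_top).ne,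
    lintegral_eq_lintegral_superlevel (hhm.min measurable_const)
      fun x => ((min_le_right _ _).trans_lt ENNReal.one_lt_top).ne]
  have hanti : ∀ u : ℝ → ℝ≥0∞,
      Measurable fun t : ℝ => volume {x | ENNReal.ofReal t < u x} := fun u =>
    Antitone.measurable fun s t hst => measure_mono fun x hx =>
      lt_of_le_of_lt (ENNReal.ofReal_le_ofReal hst) hx
  rw [← lintegral_const_mul _ (hanti f), ← lintegral_const_mul _ (hanti g),
    ← lintegral_add_left ((hanti f).const_mul _)]
  refine setLIntegral_mono' measurableSet_Ioi fun t ht => ?_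
  rcases lt_or_ge t 1 with ht1 | ht1
  · have hlt : ENNReal.ofReal t < 1 := by simpa using ht1
    refine volume_add_le_of_combination_mem ?_ ?_ ?_ ha hb ?_
    · rw [← hf1, lt_iSup_iff] at hlt
      exact hlt
    · rw [← hg1, lt_iSup_iff] at hlt
      exact hlt
    · have : {x | ENNReal.ofReal t < min (h x) 1} = {x | ENNReal.ofReal t < h x} := by
        ext x; simp only [Set.mem_ofPred_eq, lt_min_iff, hlt, and_true]
      rw [this]
      exact hh _
    · intro x hx y hy
      refine lt_min (lt_of_lt_of_le ?_ (H x y)) hlt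
      have hm : ENNReal.ofReal t < min (f x) (g y) := lt_min hx hy
      refine lt_of_lt_of_le hm ?_
      calc min (f x) (g y) = min (f x) (g y) ^ a * min (f x) (g y) ^ b := by
            rw [← ENNReal.rpow_add_of_nonneg a b ha.le hb.le, hab, ENNReal.rpow_one]
        _ ≤ f x ^ a * g y ^ b := by gcongr <;> simp
  · have h1 : 1 ≤ ENNReal.ofReal t := by simpa using ht1
    have e : ∀ u : ℝ → ℝ≥0∞, (∀ x, u x ≤ 1) → {x | ENNReal.ofReal t < u x} = ∅ := by
      intro u hu
      ext x
      simp only [Set.mem_ofPred_eq, Set.mem_empty_iff_false, iff_false, not_lt]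
      exact (hu x).trans h1
    simp [e f hfle, e g hgle]

theorem prekopa_leindler_of_iSup_ne_top {f g h : ℝ → ℝ≥0∞}
    (hf : Measurable f) (hg : Measurable g)
    (hh : ∀ c, Set.OrdConnected {x | c < h x}) (hf1 : ⨆ x, f x ≠ ∞) (hg1 : ⨆ x, g x ≠ ∞)
    {a b : ℝ} (ha : 0 < a) (hb : 0 < b) (hab : a + b = 1)
    (H : ∀ x y, f x ^ a * g y ^ b ≤ h (a * x + b * y)) :
    (∫⁻ x, f x) ^ a * (∫⁻ x, g x) ^ b ≤ ∫⁻ x, h x := by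
  set A := ⨆ x, f x with hA
  set B := ⨆ x, g x with hB
  rcases eq_or_ne A 0 with hA0 | hA0
  · have : ∀ x, f x = 0 := fun x => by
      simpa [hA0] using (le_iSup f x).trans_eq hA.symm
    simp [this, ENNReal.zero_rpow_of_pos ha]
  rcases eq_or_ne B 0 with hB0 | hB0
  · have : ∀ x, g x = 0 := fun x => by
      simpa [hB0] using (le_iSup g x).trans_eq hB.symm
    simp [this, ENNReal.zero_rpow_of_pos hb]
  set C := A ^ a * B ^ b with hC
  have hAa0 : A ^ a ≠ 0 := by simp [ENNReal.rpow_eq_zero_iff, hA0, hf1]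
  have hBb0 : B ^ b ≠ 0 := by simp [ENNReal.rpow_eq_zero_iff, hB0, hg1]
  have hAat : A ^ a ≠ ∞ := ENNReal.rpow_ne_top_of_nonneg ha.le hf1
  have hBbt : B ^ b ≠ ∞ := ENNReal.rpow_ne_top_of_nonneg hb.le hg1
  have hC0 : C ≠ 0 := mul_ne_zero hAa0 hBb0
  have hCt : C ≠ ∞ := ENNReal.mul_ne_top hAat hBbt
  have hhm : Measurable h := measurable_of_ordConnected_superlevel hh
  have hsplit : ∀ u v : ℝ≥0∞, (A⁻¹ * u) ^ a * (B⁻¹ * v) ^ b = C⁻¹ * (u ^ a * v ^ b) := by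
    intro u v
    rw [ENNReal.mul_rpow_of_nonneg _ _ ha.le, ENNReal.mul_rpow_of_nonneg _ _ hb.le,
      ENNReal.inv_rpow, ENNReal.inv_rpow, hC,
      ENNReal.mul_inv (Or.inl hAa0) (Or.inl hAat)]
    ring
  have h1 := arith_mean_lintegral_le_of_iSup_eq_one (f := fun x => A⁻¹ * f x)
    (g := fun x => B⁻¹ * g x) (h := fun x => C⁻¹ * h x) (hf.const_mul _) (hg.const_mul _)
    (fun c => by
      have : {x | c < C⁻¹ * h x} = {x | C * c < h x} := by
        ext x
        simp only [Set.mem_ofPred_eq]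
        rw [← ENNReal.mul_lt_mul_iff_right hC0 hCt (b := c), ← mul_assoc,
          ENNReal.mul_inv_cancel hC0 hCt, one_mul]
      rw [this]
      exact hh _)
    (by rw [← ENNReal.mul_iSup, ← hA, ENNReal.inv_mul_cancel hA0 hf1])
    (by rw [← ENNReal.mul_iSup, ← hB, ENNReal.inv_mul_cancel hB0 hg1]) ha hb hab
    (fun x y => by
      rw [hsplit]
      gcongr
      exact H x y)
  have h2 := (ennreal_geom_mean_le_arith_mean ha hb hab _ _).trans h1
  rw [lintegral_const_mul _ hf, lintegral_const_mul _ hg, lintegral_const_mul _ hhm,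
    hsplit] at h2
  exact (ENNReal.mul_le_mul_iff_right (ENNReal.inv_ne_zero.2 hCt) (ENNReal.inv_ne_top.2 hC0)).1 h2

theorem lintegral_eq_iSup_lintegral_min {f : ℝ → ℝ≥0∞} (hf : Measurable f) :
    ∫⁻ x, f x = ⨆ n : ℕ, ∫⁻ x, min (f x) n := by
  rw [← lintegral_iSup (fun n => hf.min measurable_const)]
  · congr 1
    ext x
    apply le_antisymm
    · induction h : f x with
      | top =>
        simp [ENNReal.iSup_natCast]
      | coe r =>
        obtain ⟨n, hn⟩ := exists_nat_ge r
        refine le_trans ?_ (le_iSup _ n)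
        exact le_min le_rfl (by exact_mod_cast hn)
    · exact iSup_le fun n => min_le_left _ _
  · intro m n hmn x
    exact min_le_min le_rfl (by exact_mod_cast hmn)

/-- The one-dimensional Prékopa–Leindler inequality. -/
theorem prekopa_leindler_real {f g h : ℝ → ℝ≥0∞}
    (hf : Measurable f) (hg : Measurable g)
    (hh : ∀ c, Set.OrdConnected {x | c < h x})
    {a b : ℝ} (ha : 0 < a) (hb : 0 < b) (hab : a + b = 1)
    (H : ∀ x y, f x ^ a * g y ^ b ≤ h (a * x + b * y)) :
    (∫⁻ x, f x) ^ a * (∫⁻ x, g x) ^ b ≤ ∫⁻ x, h x := by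
  have hs : ∀ (c : ℝ) (_ : 0 < c) (u : ℕ → ℝ≥0∞), (⨆ n, u n) ^ c = ⨆ n, u n ^ c :=
    fun c hc u => (ENNReal.orderIsoRpow c hc).map_iSup u
  rw [lintegral_eq_iSup_lintegral_min hf, lintegral_eq_iSup_lintegral_min hg, hs a ha, hs b hb,
    ENNReal.iSup_mul]
  refine iSup_le fun m => ?_
  rw [ENNReal.mul_iSup]
  refine iSup_le fun n => ?_
  refine prekopa_leindler_of_iSup_ne_top (hf.min measurable_const) (hg.min measurable_const) hh
    ?_ ?_ ha hb hab fun x y => le_trans ?_ (H x y)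
  · exact ((iSup_le fun x => min_le_right _ _).trans_lt (ENNReal.natCast_lt_top m)).ne
  · exact ((iSup_le fun x => min_le_right _ _).trans_lt (ENNReal.natCast_lt_top n)).ne
  · gcongr <;> exact min_le_left _ _

/-- Integrating a log-concave function over one real variable keeps it log-concave. -/
theorem LogConcaveFun.lintegral_real {E : Type*} [AddCommGroup E] [Module ℝ E]
    {F : E × ℝ → ℝ≥0∞} (hF : LogConcaveFun F) : LogConcaveFun fun v => ∫⁻ s, F (v, s) := by
  have hslice : ∀ v, LogConcaveFun fun s => F (v, s) := by
    intro v x y a b ha hb hab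
    have := hF (v, x) (v, y) a b ha hb hab
    simpa [← add_smul, hab] using this
  intro v w a b ha hb hab
  refine prekopa_leindler_real
    (measurable_of_ordConnected_superlevel (hslice v).ordConnected_superlevel)
    (measurable_of_ordConnected_superlevel (hslice w).ordConnected_superlevel)
    (hslice _).ordConnected_superlevel ha hb hab fun x y => ?_
  simpa using hF (v, x) (w, y) a b ha hb hab

/-- Marginals of log-concave functions are log-concave. -/
theorem LogConcaveFun.lintegral_pi {E : Type*} [AddCommGroup E] [Module ℝ E] {n : ℕ}
    {F : E × (Fin n → ℝ) → ℝ≥0∞} (hF : LogConcaveFun F)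
    (hm : ∀ v, AEMeasurable (fun x => F (v, x)) volume) :
    LogConcaveFun fun v => ∫⁻ x, F (v, x) := by
  induction n with
  | zero =>
    intro v w a b ha hb hab
    have e : ∀ v, ∫⁻ x, F (v, x) = F (v, 0) := by
      intro v
      rw [lintegral_unique, volume_pi, Measure.pi_univ]
      simp only [Finset.univ_eq_empty, Finset.prod_empty, mul_one]
      exact congrArg (fun z => F (v, z)) (Subsingleton.elim _ _)
    simp only [e]
    simpa using hF (v, 0) (w, 0) a b ha hb hab
  | succ n ih =>
    let e := MeasurableEquiv.piFinSuccAbove (fun _ : Fin (n + 1) => ℝ) 0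
    have he : MeasurePreserving e.symm volume volume :=
      (volume_preserving_piFinSuccAbove (fun _ : Fin (n + 1) => ℝ) 0).symm e
    have hcons : ∀ z : ℝ × (Fin n → ℝ), e.symm z = Fin.cons z.1 z.2 := by
      intro z
      simp [e, MeasurableEquiv.piFinSuccAbove_symm_apply, Fin.insertNthEquiv]
    let F' : (E × (Fin n → ℝ)) × ℝ → ℝ≥0∞ := fun z => F (z.1.1, Fin.cons z.2 z.1.2)
    have hF' : LogConcaveFun F' := by
      intro x y a b ha hb hab
      have := hF (x.1.1, Fin.cons x.2 x.1.2) (y.1.1, Fin.cons y.2 y.1.2) a b ha hb hab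
      have h2 : a • (Fin.cons x.2 x.1.2 : Fin (n + 1) → ℝ) + b • (Fin.cons y.2 y.1.2)
          = Fin.cons (a • x.2 + b • y.2) (a • x.1.2 + b • y.1.2) := by
        ext i
        refine Fin.cases ?_ (fun j => ?_) i <;> simp
      simpa only [F', Prod.smul_mk, Prod.mk_add_mk, h2, Prod.fst_add, Prod.snd_add,
        Prod.smul_fst, Prod.smul_snd] using this
    have hm' : ∀ v, AEMeasurable (fun z : ℝ × (Fin n → ℝ) => F (v, Fin.cons z.1 z.2))
        (volume.prod volume) := by
      intro v
      have := AEMeasurable.comp_quasiMeasurePreserving (hm v)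
        he.quasiMeasurePreserving
      simp only [Function.comp_def, hcons] at this
      exact this
    have hint : ∀ v, ∫⁻ x, F (v, x) = ∫⁻ y, ∫⁻ s, F' ((v, y), s) := by
      intro v
      rw [← he.lintegral_comp_emb e.symm.measurableEmbedding]
      simp only [hcons]
      exact lintegral_prod_symm _ (hm' v)
    simp only [hint]
    exact ih hF'.lintegral_real fun v => (hm' v).lintegral_prod_left'

/-! ### Moments of random variables with a log-concave tail -/

/-- A nonnegative, nonincreasing, log-concave function on the line, such as the tail function
`s ↦ ν (s, ∞)` of a log-concave distribution. -/
structure IsLogConcaveTail (φ : ℝ → ℝ) : Prop where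
  nonneg : ∀ s, 0 ≤ φ s
  antitone : Antitone φ
  logConcave : ∀ x y a b : ℝ, 0 < a → 0 < b → a + b = 1 →
    φ x ^ a * φ y ^ b ≤ φ (a * x + b * y)

/-- If a log-concave tail decays exponentially between `x` and `y`, it keeps doing so beyond `y`. -/
theorem IsLogConcaveTail.exp_decay {φ : ℝ → ℝ} (h : IsLogConcaveTail φ) {x y k : ℝ} (hxy : x < y)
    (hk : φ y ≤ φ x * Real.exp (-(k * (y - x)))) {s : ℝ} (hs : y ≤ s) :
    φ s ≤ φ y * Real.exp (-(k * (s - y))) := by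
  rcases hs.eq_or_lt with rfl | hs
  · simp
  rcases (h.nonneg s).eq_or_lt with h0 | h0
  · rw [← h0]; exact mul_nonneg (h.nonneg y) (Real.exp_pos _).le
  have hy0 : 0 < φ y := h0.trans_le (h.antitone hs.le)
  have hx0 : 0 < φ x := hy0.trans_le (h.antitone hxy.le)
  have hsx : 0 < s - x := by linarith
  have h1 := h.logConcave x s ((s - y) / (s - x)) ((y - x) / (s - x))
    (div_pos (by linarith) hsx) (div_pos (by linarith) hsx) (by field_simp; ring)
  have e : (s - y) / (s - x) * x + (y - x) / (s - x) * s = y := by field_simp; ring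
  rw [e] at h1
  have h2 := Real.log_le_log (by positivity) h1
  rw [Real.log_mul (by positivity) (by positivity), Real.log_rpow hx0, Real.log_rpow h0] at h2
  have h3 := Real.log_le_log hy0 hk
  rw [Real.log_mul hx0.ne' (Real.exp_pos _).ne', Real.log_exp] at h3
  rw [← Real.log_le_log_iff h0 (by positivity), Real.log_mul hy0.ne' (Real.exp_pos _).ne',
    Real.log_exp]
  have h4 : (s - y) * Real.log (φ x) + (y - x) * Real.log (φ s) ≤ (s - x) * Real.log (φ y) := by
    have := mul_le_mul_of_nonneg_left h2 hsx.le
    have e2 : (s - x) * ((s - y) / (s - x) * Real.log (φ x) + (y - x) / (s - x) * Real.log (φ s))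
        = (s - y) * Real.log (φ x) + (y - x) * Real.log (φ s) := by field_simp
    rwa [e2] at this
  have h5 := mul_le_mul_of_nonneg_left h3 (sub_pos.2 hs).le
  have h6 : (y - x) * Real.log (φ s) ≤ (y - x) * (Real.log (φ y) + -(k * (s - y))) := by
    nlinarith
  exact le_of_mul_le_mul_left h6 (sub_pos.2 hxy)

theorem integrableOn_pow_mul_exp_neg {k : ℝ} (hk : 0 < k) (n : ℕ) :
    IntegrableOn (fun s : ℝ => s ^ n * Real.exp (-(k * s))) (Set.Ioi 0) := by
  have := integrableOn_rpow_mul_exp_neg_mul_rpow (p := 1) (s := n) (b := k)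
    (by have : (0 : ℝ) ≤ n := n.cast_nonneg
        linarith) one_pos hk
  simpa [neg_mul] using this

theorem integral_pow_mul_exp_neg {k : ℝ} (hk : 0 < k) (n : ℕ) :
    ∫ s in Set.Ioi (0 : ℝ), s ^ n * Real.exp (-(k * s)) = n.factorial / k ^ (n + 1) := by
  have := Real.integral_rpow_mul_exp_neg_mul_Ioi (a := (n : ℝ) + 1) (r := k) (by positivity) hk
  rw [Real.Gamma_nat_eq_factorial] at this
  simp only [add_sub_cancel_right, Real.rpow_natCast] at this
  rw [this]
  have e : ((n : ℝ) + 1) = ((n + 1 : ℕ) : ℝ) := by push_cast; rfl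
  rw [e, Real.rpow_natCast, one_div, inv_pow, div_eq_inv_mul]

theorem IsLogConcaveTail.integrableOn_mul_pow {φ : ℝ → ℝ} (h : IsLogConcaveTail φ) {C k : ℝ}
    (hk : 0 < k) (hC : ∀ s, 0 < s → φ s ≤ C * Real.exp (-(k * s))) (n : ℕ) :
    IntegrableOn (fun s => φ s * s ^ n) (Set.Ioi 0) := by
  refine Integrable.mono' ((integrableOn_pow_mul_exp_neg hk n).const_mul C) ?_ ?_
  · exact (h.antitone.measurable.mul (by fun_prop)).aestronglyMeasurable
  · refine (ae_restrict_iff' measurableSet_Ioi).2 (ae_of_all _ fun s (hs : 0 < s) => ?_)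
    rw [Real.norm_of_nonneg (mul_nonneg (h.nonneg s) (by positivity))]
    calc φ s * s ^ n ≤ C * Real.exp (-(k * s)) * s ^ n := by
          gcongr
          exact hC s hs
      _ = C * (s ^ n * Real.exp (-(k * s))) := by ring

/-- Comparison of the third moment of a log-concave tail with the first one; equality holds for
exponential tails. -/
theorem IsLogConcaveTail.integral_mul_pow_three_le {φ : ℝ → ℝ} (h : IsLogConcaveTail φ) {C k : ℝ}
    (hk : 0 < k) (hC : ∀ s, 0 < s → φ s ≤ C * Real.exp (-(k * s))) (hm : 0 < φ 0) :
    ∫ s in Set.Ioi (0 : ℝ), φ s * s ^ 3 ≤ 6 * (∫ s in Set.Ioi (0 : ℝ), φ s * s ^ 1) ^ 2 / φ 0 := by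
  have i1 := h.integrableOn_mul_pow hk hC 1
  have i3 := h.integrableOn_mul_pow hk hC 3
  set S := ∫ s in Set.Ioi (0 : ℝ), φ s * s ^ 1 with hS
  have hnn : ∀ n : ℕ, 0 ≤ᵐ[volume.restrict (Set.Ioi (0 : ℝ))] fun s => φ s * s ^ n := fun n =>
    (ae_restrict_iff' measurableSet_Ioi).2 (ae_of_all _ fun s (hs : 0 < s) =>
      mul_nonneg (h.nonneg s) (by positivity))
  have hS0 : 0 ≤ S := integral_nonneg_of_ae (hnn 1)
  rcases hS0.eq_or_lt with hS0 | hS0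
  · have := (setIntegral_eq_zero_iff_of_nonneg_ae (hnn 1) i1).1 hS0.symm
    have h3 : ∫ s in Set.Ioi (0 : ℝ), φ s * s ^ 3 = 0 := by
      apply integral_eq_zero_of_ae
      filter_upwards [this] with s hs
      simp only [Pi.zero_apply] at hs ⊢
      calc φ s * s ^ 3 = (φ s * s ^ 1) * s ^ 2 := by ring
        _ = 0 := by rw [hs, zero_mul]
    rw [h3, ← hS0]; simp
  set m := φ 0 with hmdef
  set c := Real.sqrt (m / S) with hc
  have hc0 : 0 < c := Real.sqrt_pos.2 (div_pos hm hS0)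
  have hc2 : c ^ 2 = m / S := Real.sq_sqrt (div_pos hm hS0).le
  set ψ : ℝ → ℝ := fun s => m * Real.exp (-(c * s)) with hψ
  have j : ∀ n : ℕ, IntegrableOn (fun s => ψ s * s ^ n) (Set.Ioi 0) := fun n =>
    ((integrableOn_pow_mul_exp_neg hc0 n).const_mul m).congr (ae_of_all _ fun s => by
      simp only [hψ]; ring)
  have jv : ∀ n : ℕ, ∫ s in Set.Ioi (0 : ℝ), ψ s * s ^ n = m * (n.factorial / c ^ (n + 1)) := by
    intro n
    rw [← integral_pow_mul_exp_neg hc0 n, ← integral_const_mul]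
    congr 1
    ext s
    simp only [hψ]; ring
  have jv1 : ∫ s in Set.Ioi (0 : ℝ), ψ s * s ^ 1 = S := by
    rw [jv 1, hc2]; simp; field_simp
  have jv3 : ∫ s in Set.Ioi (0 : ℝ), ψ s * s ^ 3 = 6 * S ^ 2 / m := by
    rw [jv 3]
    have : c ^ (3 + 1) = (m / S) ^ 2 := by rw [← hc2]; ring
    rw [this]
    norm_num [Nat.factorial]
    field_simp
  rw [← jv3]
  have hstar : ∀ s s', 0 < s' → s' ≤ s → ψ s ≤ φ s → ψ s' ≤ φ s' := by
    intro s s' hs' hss' hle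
    rcases hss'.eq_or_lt with rfl | hss'
    · exact hle
    by_contra hcon
    push Not at hcon
    have h1 := h.exp_decay (x := 0) (y := s') (k := c) hs' (by simpa [hψ] using hcon.le) hss'.le
    have h2 : φ s' * Real.exp (-(c * (s - s'))) < ψ s' * Real.exp (-(c * (s - s'))) :=
      mul_lt_mul_of_pos_right hcon (Real.exp_pos _)
    have h3 : ψ s' * Real.exp (-(c * (s - s'))) = ψ s := by
      simp only [hψ]
      rw [mul_assoc, ← Real.exp_add]
      congr 2
      ring
    linarith
  by_cases hbdd : ∃ M, ∀ s, 0 < s → ψ s ≤ φ s → s ≤ M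
  · obtain ⟨r, hr⟩ : ∃ r : ℝ, ∀ s, 0 < s → (s < r → ψ s ≤ φ s) ∧ (r < s → φ s ≤ ψ s) := by
      obtain ⟨M, hM⟩ := hbdd
      have hbdd' : BddAbove {s | 0 < s ∧ ψ s ≤ φ s} := ⟨M, fun s hs => hM s hs.1 hs.2⟩
      by_cases hne : {s | 0 < s ∧ ψ s ≤ φ s}.Nonempty
      · refine ⟨sSup {s | 0 < s ∧ ψ s ≤ φ s}, fun s hs => ⟨fun hlt => ?_, fun hlt => ?_⟩⟩
        · obtain ⟨u, hu, hsu⟩ := exists_lt_of_lt_csSup hne hlt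
          exact hstar u s hs hsu.le hu.2
        · by_contra hcon
          push Not at hcon
          exact absurd (le_csSup hbdd' ⟨hs, hcon.le⟩) (not_le.2 hlt)
      · refine ⟨0, fun s hs => ⟨fun hlt => absurd hlt (not_lt.2 hs.le), fun _ => ?_⟩⟩
        by_contra hcon
        push Not at hcon
        exact hne ⟨s, hs, hcon.le⟩
    have hr' : ∀ s, 0 < s → (φ s - ψ s) * (s ^ 2 - r ^ 2) ≤ 0 ∨ r < 0 := by
      intro s hs
      rcases lt_or_ge r 0 with h0 | h0
      · exact Or.inr h0
      left
      rcases lt_trichotomy s r with hlt | heq | hlt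
      · exact mul_nonpos_of_nonneg_of_nonpos (sub_nonneg.2 ((hr s hs).1 hlt)) (by nlinarith)
      · rw [heq]; simp
      · exact mul_nonpos_of_nonpos_of_nonneg (sub_nonpos.2 ((hr s hs).2 hlt)) (by nlinarith)
    have hle : ∃ t : ℝ, ∀ s, 0 < s → φ s * s ^ 3 - ψ s * s ^ 3 ≤ t * (φ s * s ^ 1 - ψ s * s ^ 1) := by
      rcases lt_or_ge r 0 with h0 | h0
      · refine ⟨0, fun s hs => ?_⟩
        have := (hr s hs).2 (h0.trans hs)
        have := mul_le_mul_of_nonneg_right this (pow_pos hs 3).le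
        linarith
      · refine ⟨r ^ 2, fun s hs => ?_⟩
        have h1 := (hr' s hs).resolve_right (not_lt.2 h0)
        have := mul_nonneg_of_nonpos_of_nonpos h1 (neg_nonpos.2 hs.le)
        nlinarith
    obtain ⟨t, ht⟩ := hle
    have := setIntegral_mono_on (i3.sub (j 3)) ((i1.sub (j 1)).const_mul t) measurableSet_Ioi
      (fun s hs => ht s hs)
    simp only [Pi.sub_apply] at this
    rw [integral_sub i3 (j 3), integral_const_mul, integral_sub i1 (j 1), jv1, ← hS, sub_self,
      mul_zero] at this
    linarith
  · push Not at hbdd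
    have hge : ∀ s, 0 < s → ψ s ≤ φ s := by
      intro s hs
      obtain ⟨u, hu, hu2, hsu⟩ := hbdd s
      exact hstar u s hs hsu.le hu2
    have hz : ∫ s in Set.Ioi (0 : ℝ), (φ s * s ^ 1 - ψ s * s ^ 1) = 0 := by
      rw [integral_sub i1 (j 1), jv1, ← hS, sub_self]
    have hae := (setIntegral_eq_zero_iff_of_nonneg_ae
      ((ae_restrict_iff' measurableSet_Ioi).2 (ae_of_all _ fun s (hs : 0 < s) => by
        simp only [Pi.zero_apply, Pi.sub_apply]
        rw [← sub_mul]
        exact mul_nonneg (sub_nonneg.2 (hge s hs)) (by positivity))) (i1.sub (j 1))).1 hz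
    apply le_of_eq
    apply integral_congr_ae
    filter_upwards [hae] with s hs
    simp only [Pi.zero_apply, Pi.sub_apply] at hs
    calc φ s * s ^ 3 = (φ s * s ^ 1 - ψ s * s ^ 1) * s ^ 2 + ψ s * s ^ 3 := by ring
      _ = ψ s * s ^ 3 := by rw [hs]; ring

theorem IsLogConcaveTail.one_sixth_le {φ : ℝ → ℝ} (h : IsLogConcaveTail φ) {D : ℝ} (hD : 0 < D)
    (hint : ∫ s in Set.Ioi (0 : ℝ), φ s = D) (hhalf : 1 / 2 ≤ φ (-(2 * D))) : 1 / 6 ≤ φ 0 := by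
  by_contra hcon
  push Not at hcon
  have hexp : (1 : ℝ) / 3 ≤ Real.exp (-1) := by
    rw [Real.exp_neg, ← one_div]
    exact one_div_le_one_div_of_le (Real.exp_pos _) (by linarith [Real.exp_one_lt_d9])
  have hk : 0 < 1 / (2 * D) := by positivity
  have h1 : ∀ s, 0 < s → φ s ≤ φ 0 * Real.exp (-(1 / (2 * D) * s)) := by
    intro s hs
    have := h.exp_decay (x := -(2 * D)) (y := 0) (k := 1 / (2 * D)) (by linarith) (by
      have e : 1 / (2 * D) * (0 - -(2 * D)) = 1 := by field_simp; ring
      rw [e]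
      nlinarith) hs.le
    simpa using this
  have i0 := h.integrableOn_mul_pow hk h1 0
  have j0 := (integrableOn_pow_mul_exp_neg hk 0).const_mul (φ 0)
  have := setIntegral_mono_on i0 j0 measurableSet_Ioi (fun s hs => by simpa using h1 s hs)
  rw [integral_const_mul, integral_pow_mul_exp_neg hk 0] at this
  simp only [pow_zero, mul_one, hint] at this
  simp at this
  nlinarith

/-- The tail function of a probability measure decays exponentially once it is log-concave. -/
theorem IsLogConcaveTail.exists_exp_bound {ν : Measure ℝ} [IsProbabilityMeasure ν]
    (h : IsLogConcaveTail fun s => ν.real (Set.Ioi s)) :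
    ∃ C k : ℝ, 0 < k ∧ ∀ s, 0 < s → ν.real (Set.Ioi s) ≤ C * Real.exp (-(k * s)) := by
  have hcdf : ∀ s, ν.real (Set.Ioi s) = 1 - ProbabilityTheory.cdf ν s := by
    intro s
    rw [ProbabilityTheory.cdf_eq_real, ← Set.compl_Iic, probReal_compl_eq_one_sub measurableSet_Iic]
  have hlow : ∃ x < (0 : ℝ), 1 / 2 ≤ ν.real (Set.Ioi x) := by
    have := (ProbabilityTheory.tendsto_cdf_atBot ν).eventually_lt_const (show (0 : ℝ) < 1 / 2 by norm_num)
    obtain ⟨x, hx, hx0⟩ := (this.and (eventually_lt_atBot 0)).exists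
    exact ⟨x, hx0, by rw [hcdf]; linarith⟩
  have hhigh : ∃ y > (0 : ℝ), ν.real (Set.Ioi y) ≤ 1 / 2 * Real.exp (-1) := by
    have he := Real.exp_pos (-1)
    have := (ProbabilityTheory.tendsto_cdf_atTop ν).eventually_const_lt
      (u := 1 - 1 / 2 * Real.exp (-1)) (by linarith)
    obtain ⟨y, hy, hy0⟩ := (this.and (eventually_gt_atTop 0)).exists
    exact ⟨y, hy0, by rw [hcdf]; linarith⟩
  obtain ⟨x, hx0, hx⟩ := hlow
  obtain ⟨y, hy0, hy⟩ := hhigh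
  have hyx : 0 < y - x := by linarith
  have hk : 0 < 1 / (y - x) := by positivity
  refine ⟨Real.exp (1 / (y - x) * y), 1 / (y - x), hk, fun s hs => ?_⟩
  rw [← Real.exp_add]
  rcases le_total y s with hys | hys
  · have := h.exp_decay (x := x) (y := y) (k := 1 / (y - x)) (by linarith) (by
      have e : 1 / (y - x) * (y - x) = 1 := by field_simp
      rw [e]
      exact hy.trans (mul_le_mul_of_nonneg_right hx (Real.exp_pos _).le)) hys
    refine this.trans ((mul_le_of_le_one_left (Real.exp_pos _).le measureReal_le_one).trans ?_)
    apply Real.exp_le_exp.2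
    linarith
  · refine measureReal_le_one.trans (Real.one_le_exp ?_)
    have := mul_le_mul_of_nonneg_left hys hk.le
    linarith

/-- Layer-cake formula for the moments of the positive part. -/
theorem IsLogConcaveTail.integral_posPart_pow {ν : Measure ℝ} [IsProbabilityMeasure ν]
    (h : IsLogConcaveTail fun s => ν.real (Set.Ioi s)) (n : ℕ) :
    Integrable (fun x => max x 0 ^ (n + 1)) ν ∧ ∫ x, max x 0 ^ (n + 1) ∂ν =
      (n + 1) * ∫ s in Set.Ioi (0 : ℝ), ν.real (Set.Ioi s) * s ^ n := by
  obtain ⟨C, k, hk, hC⟩ := h.exists_exp_bound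
  have hi := h.integrableOn_mul_pow hk hC n
  have hlc := lintegral_rpow_eq_lintegral_meas_lt_mul ν (f := fun x : ℝ => max x 0)
    (ae_of_all _ fun x => le_max_right _ _) (by fun_prop) (p := (n : ℝ) + 1) (by positivity)
  have hn1 : ((n : ℝ) + 1) = ((n + 1 : ℕ) : ℝ) := by push_cast; rfl
  have hr : ∫⁻ t in Set.Ioi (0 : ℝ), ν {a | t < max a 0} * ENNReal.ofReal (t ^ ((n : ℝ) + 1 - 1))
      = ENNReal.ofReal (∫ s in Set.Ioi (0 : ℝ), ν.real (Set.Ioi s) * s ^ n) := by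
    rw [ofReal_integral_eq_lintegral_ofReal hi ((ae_restrict_iff' measurableSet_Ioi).2
      (ae_of_all _ fun s (hs : 0 < s) => mul_nonneg measureReal_nonneg (by positivity)))]
    refine setLIntegral_congr_fun measurableSet_Ioi fun t (ht : 0 < t) => ?_
    have e : {a : ℝ | t < max a 0} = Set.Ioi t := by
      ext a
      simp [not_lt.2 ht.le]
    simp only [e, add_sub_cancel_right, Real.rpow_natCast]
    rw [ENNReal.ofReal_mul measureReal_nonneg, ofReal_measureReal]
  have hL : ∀ x : ℝ, max x 0 ^ ((n : ℝ) + 1) = max x 0 ^ (n + 1) := by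
    intro x
    rw [hn1, Real.rpow_natCast]
  simp only [hL] at hlc
  rw [hr] at hlc
  have hnn : 0 ≤ᵐ[ν] fun x : ℝ => max x 0 ^ (n + 1) :=
    ae_of_all _ fun x => pow_nonneg (le_max_right _ _) _
  have hmeas : AEStronglyMeasurable (fun x : ℝ => max x 0 ^ (n + 1)) ν :=
    Continuous.aestronglyMeasurable (by fun_prop)
  refine ⟨(lintegral_ofReal_ne_top_iff_integrable hmeas hnn).1 ?_, ?_⟩
  · rw [hlc]
    exact ENNReal.mul_ne_top ENNReal.ofReal_ne_top ENNReal.ofReal_ne_top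
  · rw [integral_eq_lintegral_of_nonneg_ae hnn hmeas, hlc, ENNReal.toReal_mul,
      ENNReal.toReal_ofReal (by positivity), ENNReal.toReal_ofReal]
    exact setIntegral_nonneg measurableSet_Ioi fun s (hs : 0 < s) =>
      mul_nonneg measureReal_nonneg (by positivity)

/-- Fourth moment of the positive part of a centered variable with log-concave tail. -/
theorem IsLogConcaveTail.integral_posPart_pow_four_le {ν : Measure ℝ} [IsProbabilityMeasure ν]
    (h : IsLogConcaveTail fun s => ν.real (Set.Ioi s)) (hi : Integrable (fun x => x) ν)
    (h0 : ∫ x, x ∂ν = 0) :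
    ∫ x, max x 0 ^ 4 ∂ν ≤ 36 * (∫ x, max x 0 ^ 2 ∂ν) ^ 2 := by
  obtain ⟨C, k, hk, hC⟩ := h.exists_exp_bound
  have h1 := h.integral_posPart_pow 0
  have h2 := h.integral_posPart_pow 1
  have h4 := h.integral_posPart_pow 3
  simp only [zero_add, pow_one, pow_zero, mul_one, Nat.cast_zero, one_mul] at h1
  have hDnn : 0 ≤ ∫ x, max x 0 ∂ν := integral_nonneg fun x => le_max_right _ _
  rcases hDnn.eq_or_lt with hD | hD
  · have := (integral_eq_zero_iff_of_nonneg (fun x => le_max_right x 0) h1.1).1 hD.symm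
    have e : ∫ x, max x 0 ^ 4 ∂ν = 0 := by
      apply integral_eq_zero_of_ae
      filter_upwards [this] with x hx
      simp only [Pi.zero_apply] at hx ⊢
      rw [hx]; norm_num
    rw [e]; positivity
  have hneg : ∫ x, max (-x) 0 ∂ν = ∫ x, max x 0 ∂ν := by
    have e : ∀ x : ℝ, max (-x) 0 = max x 0 - x := by
      intro x
      rcases le_total x 0 with hx | hx
      · rw [max_eq_left (by linarith), max_eq_right hx]; ring
      · rw [max_eq_right (by linarith), max_eq_left hx]; ring
    simp only [e]
    rw [integral_sub h1.1 hi, h0, sub_zero]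
  set D := ∫ x, max x 0 ∂ν with hDdef
  have hineg : Integrable (fun x : ℝ => max (-x) 0) ν := hi.neg.sup (integrable_const 0)
  have hmk := mul_meas_ge_le_integral_of_nonneg
    (ae_of_all ν fun x : ℝ => le_max_right (-x) 0) hineg (2 * D)
  rw [hneg] at hmk
  have hhalf : 1 / 2 ≤ ν.real (Set.Ioi (-(2 * D))) := by
    rw [← Set.compl_Iic, probReal_compl_eq_one_sub measurableSet_Iic]
    have e : ν.real (Set.Iic (-(2 * D))) ≤ ν.real {x | 2 * D ≤ max (-x) 0} :=
      by
      refine measureReal_mono fun x (hx : x ≤ -(2 * D)) => ?_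
      show 2 * D ≤ max (-x) 0
      exact le_max_of_le_left (by linarith)
    have e2 : ν.real {x : ℝ | 2 * D ≤ max (-x) 0} ≤ 1 / 2 := by
      by_contra hcon
      push Not at hcon
      nlinarith
    linarith
  have hm := h.one_sixth_le hD h1.2.symm hhalf
  have hkey := h.integral_mul_pow_three_le hk hC (by linarith)
  have e4 := h4.2
  have e2 := h2.2
  norm_num at e4 e2
  rw [e4, e2]
  simp only [pow_one] at hkey
  set S := ∫ s in Set.Ioi (0 : ℝ), ν.real (Set.Ioi s) * s
  have : 6 * S ^ 2 / ν.real (Set.Ioi 0) ≤ 36 * S ^ 2 := by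
    rw [div_le_iff₀ (by linarith)]
    nlinarith [sq_nonneg S]
  nlinarith

/-- A centered real random variable whose two tails are log-concave has finite fourth moment,
controlled by the square of its variance. -/
theorem integral_pow_four_le_of_isLogConcaveTail {ν : Measure ℝ} [IsProbabilityMeasure ν]
    (h : IsLogConcaveTail fun s => ν.real (Set.Ioi s))
    (h' : IsLogConcaveTail fun s => (ν.map Neg.neg).real (Set.Ioi s)) :
    Integrable (fun x => x ^ 4) ν ∧
      (∫ x, x ∂ν = 0 → ∫ x, x ^ 4 ∂ν ≤ 36 * (∫ x, x ^ 2 ∂ν) ^ 2) := by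
  have hν' : IsProbabilityMeasure (ν.map Neg.neg) :=
    Measure.isProbabilityMeasure_map measurable_neg.aemeasurable
  have hmap : ∀ u : ℝ → ℝ, Continuous u → ∫ x, u x ∂(ν.map Neg.neg) = ∫ x, u (-x) ∂ν :=
    fun u hu => integral_map measurable_neg.aemeasurable hu.aestronglyMeasurable
  have imap : ∀ u : ℝ → ℝ, Continuous u →
      (Integrable u (ν.map Neg.neg) ↔ Integrable (fun x => u (-x)) ν) :=
    fun u hu => integrable_map_measure hu.aestronglyMeasurable measurable_neg.aemeasurable
  have hpow : ∀ n : ℕ, Integrable (fun x : ℝ => max (-x) 0 ^ (n + 1)) ν := fun n =>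
    (imap _ (by fun_prop)).1 (h'.integral_posPart_pow n).1
  have e4 : ∀ x : ℝ, x ^ 4 = max x 0 ^ 4 + max (-x) 0 ^ 4 := by
    intro x
    rcases le_total x 0 with hx | hx
    · rw [max_eq_right hx, max_eq_left (by linarith)]; ring
    · rw [max_eq_left hx, max_eq_right (by linarith)]; ring
  have e2 : ∀ x : ℝ, x ^ 2 = max x 0 ^ 2 + max (-x) 0 ^ 2 := by
    intro x
    rcases le_total x 0 with hx | hx
    · rw [max_eq_right hx, max_eq_left (by linarith)]; ring
    · rw [max_eq_left hx, max_eq_right (by linarith)]; ring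
  have e1 : ∀ x : ℝ, x = max x 0 ^ 1 - max (-x) 0 ^ 1 := by
    intro x
    rcases le_total x 0 with hx | hx
    · rw [max_eq_right hx, max_eq_left (by linarith)]; ring
    · rw [max_eq_left hx, max_eq_right (by linarith)]; ring
  have i4 : Integrable (fun x : ℝ => x ^ 4) ν :=
    ((h.integral_posPart_pow 3).1.add (hpow 3)).congr (ae_of_all _ fun x => (e4 x).symm)
  have i1 : Integrable (fun x : ℝ => x) ν :=
    ((h.integral_posPart_pow 0).1.sub (hpow 0)).congr (ae_of_all _ fun x => (e1 x).symm)
  refine ⟨i4, fun h0 => ?_⟩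
  have hp := h.integral_posPart_pow_four_le i1 h0
  have hn := h'.integral_posPart_pow_four_le ((imap _ (by fun_prop)).2 i1.neg) (by
    rw [hmap _ (by fun_prop), integral_neg, h0, neg_zero])
  rw [hmap _ (by fun_prop), hmap _ (by fun_prop)] at hn
  have s4 : ∫ x, x ^ 4 ∂ν = ∫ x, max x 0 ^ 4 ∂ν + ∫ x, max (-x) 0 ^ 4 ∂ν := by
    rw [← integral_add (h.integral_posPart_pow 3).1 (hpow 3)]
    exact integral_congr_ae (ae_of_all _ e4)
  have s2 : ∫ x, x ^ 2 ∂ν = ∫ x, max x 0 ^ 2 ∂ν + ∫ x, max (-x) 0 ^ 2 ∂ν := by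
    rw [← integral_add (h.integral_posPart_pow 1).1 (hpow 1)]
    exact integral_congr_ae (ae_of_all _ e2)
  have p1 : 0 ≤ ∫ x, max x 0 ^ 2 ∂ν := integral_nonneg fun x => by positivity
  have p2 : 0 ≤ ∫ x, max (-x) 0 ^ 2 ∂ν := integral_nonneg fun x => by positivity
  rw [s4, s2]
  nlinarith [mul_nonneg p1 p2]

/-! ### Linear functionals of a log-concave random vector -/

/-- The probability measure with density `p`. -/
noncomputable def densityMeasure {d : ℕ} (p : EuclideanSpace ℝ (Fin d) → ℝ) :
    Measure (EuclideanSpace ℝ (Fin d)) :=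
  volume.withDensity fun x => ENNReal.ofReal (p x)

theorem IsLogConcaveDensity.integrable {d : ℕ} {p : EuclideanSpace ℝ (Fin d) → ℝ}
    (hp : IsLogConcaveDensity p) : Integrable p := by
  by_contra h
  have := hp.2.1
  rw [integral_undef h] at this
  exact zero_ne_one this

theorem IsLogConcaveDensity.isProbabilityMeasure {d : ℕ} {p : EuclideanSpace ℝ (Fin d) → ℝ}
    (hp : IsLogConcaveDensity p) : IsProbabilityMeasure (densityMeasure p) := by
  refine ⟨?_⟩
  rw [densityMeasure, withDensity_apply _ MeasurableSet.univ, Measure.restrict_univ,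
    ← ofReal_integral_eq_lintegral_ofReal hp.integrable (ae_of_all _ hp.1), hp.2.1,
    ENNReal.ofReal_one]

theorem IsLogConcaveDensity.integral_densityMeasure {d : ℕ} {p : EuclideanSpace ℝ (Fin d) → ℝ}
    (hp : IsLogConcaveDensity p) {G : Type*} [NormedAddCommGroup G] [NormedSpace ℝ G]
    (g : EuclideanSpace ℝ (Fin d) → G) : ∫ x, g x ∂(densityMeasure p) = ∫ x, p x • g x := by
  rw [densityMeasure, integral_withDensity_eq_integral_toReal_smul₀
    hp.integrable.1.aemeasurable.ennreal_ofReal (ae_of_all _ fun x => ENNReal.ofReal_lt_top)]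
  simp only [ENNReal.toReal_ofReal (hp.1 _)]

theorem logConcaveFun_ofReal {d : ℕ} {p : EuclideanSpace ℝ (Fin d) → ℝ}
    (hp : IsLogConcaveDensity p) : LogConcaveFun fun x => ENNReal.ofReal (p x) := by
  intro x y a b ha hb hab
  have := hp.2.2 x y a ⟨ha.le, by linarith⟩
  rw [show 1 - a = b by linarith] at this
  simp only
  rw [ENNReal.ofReal_rpow_of_nonneg (hp.1 x) ha.le, ENNReal.ofReal_rpow_of_nonneg (hp.1 y) hb.le,
    ← ENNReal.ofReal_mul (Real.rpow_nonneg (hp.1 x) _)]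
  exact ENNReal.ofReal_le_ofReal this

theorem logConcaveFun_densityMeasure_halfspace {d : ℕ} {p : EuclideanSpace ℝ (Fin d) → ℝ}
    (hp : IsLogConcaveDensity p) (L : EuclideanSpace ℝ (Fin d) →L[ℝ] ℝ) (r : ℝ) :
    LogConcaveFun fun s : ℝ => densityMeasure p {x | s < L x - r} := by
  classical
  let F : ℝ × (Fin d → ℝ) → ℝ≥0∞ := fun z =>
    if z.1 < L (WithLp.toLp 2 z.2) - r then ENNReal.ofReal (p (WithLp.toLp 2 z.2)) else 0
  have hms : ∀ s, MeasurableSet {x | s < L x - r} := fun s =>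
    measurableSet_lt measurable_const (by fun_prop)
  have hvp : MeasurePreserving (MeasurableEquiv.toLp 2 (Fin d → ℝ)) volume volume :=
    PiLp.volume_preserving_toLp (Fin d)
  have hF : LogConcaveFun F := by
    intro x y a b ha hb hab
    simp only [F]
    by_cases hx : x.1 < L (WithLp.toLp 2 x.2) - r
    · by_cases hy : y.1 < L (WithLp.toLp 2 y.2) - r
      · rw [if_pos hx, if_pos hy, if_pos]
        · exact logConcaveFun_ofReal hp _ _ a b ha hb hab
        · simp only [Prod.fst_add, Prod.smul_fst, Prod.snd_add, Prod.smul_snd, WithLp.toLp_add,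
            WithLp.toLp_smul, map_add, map_smul, smul_eq_mul]
          have hr : r = a * r + b * r := by rw [← add_mul, hab, one_mul]
          nlinarith [mul_lt_mul_of_pos_left hx ha, mul_lt_mul_of_pos_left hy hb]
      · rw [if_neg hy, ENNReal.zero_rpow_of_pos hb, mul_zero]
        exact zero_le
    · rw [if_neg hx, ENNReal.zero_rpow_of_pos ha, zero_mul]
      exact zero_le
  have hind : ∀ s z, F (s, z) = ({x | s < L x - r}.indicator fun x => ENNReal.ofReal (p x))
      (MeasurableEquiv.toLp 2 (Fin d → ℝ) z) := by
    intro s z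
    simp [F, Set.indicator_apply]
  have haem : ∀ s, AEMeasurable ({x | s < L x - r}.indicator fun x => ENNReal.ofReal (p x))
      volume := fun s => hp.integrable.1.aemeasurable.ennreal_ofReal.indicator (hms s)
  have := hF.lintegral_pi fun s => by
    simp only [hind]
    exact (haem s).comp_quasiMeasurePreserving hvp.quasiMeasurePreserving
  simp only [hind] at this
  convert this using 2 with s
  rw [hvp.lintegral_comp_emb (MeasurableEquiv.measurableEmbedding _), densityMeasure,
    withDensity_apply _ (hms s), lintegral_indicator (hms s)]

theorem isLogConcaveTail_map {d : ℕ} {p : EuclideanSpace ℝ (Fin d) → ℝ}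
    (hp : IsLogConcaveDensity p) (L : EuclideanSpace ℝ (Fin d) →L[ℝ] ℝ) (r : ℝ) :
    IsLogConcaveTail fun s => ((densityMeasure p).map fun x => L x - r).real (Set.Ioi s) := by
  have := hp.isProbabilityMeasure
  have hmeas : Measurable fun x => L x - r := by fun_prop
  have : IsProbabilityMeasure ((densityMeasure p).map fun x => L x - r) :=
    Measure.isProbabilityMeasure_map hmeas.aemeasurable
  refine ⟨fun s => measureReal_nonneg,
    fun s t hst => measureReal_mono (Set.Ioi_subset_Ioi hst), fun x y a b ha hb hab => ?_⟩
  have h := logConcaveFun_densityMeasure_halfspace hp L r x y a b ha hb hab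
  have e : ∀ s, ((densityMeasure p).map fun x => L x - r).real (Set.Ioi s)
      = (densityMeasure p {x | s < L x - r}).toReal := by
    intro s
    rw [measureReal_def, Measure.map_apply hmeas measurableSet_Ioi]
    rfl
  simp only [e]
  rw [ENNReal.toReal_rpow, ENNReal.toReal_rpow, ← ENNReal.toReal_mul]
  exact ENNReal.toReal_mono (measure_ne_top _ _) h

theorem IsLogConcaveDensity.integrable_pow_four {d : ℕ} {p : EuclideanSpace ℝ (Fin d) → ℝ}
    (hp : IsLogConcaveDensity p) (L : EuclideanSpace ℝ (Fin d) →L[ℝ] ℝ) (r : ℝ) :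
    Integrable (fun x => (L x - r) ^ 4) (densityMeasure p) ∧
      (∫ x, (L x - r) ∂(densityMeasure p) = 0 → ∫ x, (L x - r) ^ 4 ∂(densityMeasure p) ≤
        36 * (∫ x, (L x - r) ^ 2 ∂(densityMeasure p)) ^ 2) := by
  have := hp.isProbabilityMeasure
  have hmeas : Measurable fun x => L x - r := by fun_prop
  have : IsProbabilityMeasure ((densityMeasure p).map fun x => L x - r) :=
    Measure.isProbabilityMeasure_map hmeas.aemeasurable
  have hneg : ((densityMeasure p).map fun x => L x - r).map Neg.neg
      = (densityMeasure p).map fun x => (-L) x - (-r) := by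
    rw [Measure.map_map measurable_neg hmeas]
    congr 1
    ext x
    simp [sub_eq_add_neg, add_comm]
  have h := integral_pow_four_le_of_isLogConcaveTail (isLogConcaveTail_map hp L r)
    (by rw [hneg]; exact isLogConcaveTail_map hp (-L) (-r))
  have hmap : ∀ u : ℝ → ℝ, Continuous u →
      ∫ x, u x ∂((densityMeasure p).map fun x => L x - r) = ∫ x, u (L x - r) ∂(densityMeasure p) :=
    fun u hu => integral_map hmeas.aemeasurable hu.aestronglyMeasurable
  rw [integrable_map_measure (Continuous.aestronglyMeasurable (by fun_prop)) hmeas.aemeasurable,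
    hmap _ (by fun_prop), hmap _ (by fun_prop), hmap _ (by fun_prop)] at h
  exact h

/-! ### Covariance and mixed moments -/

/-- The linear functional `x ↦ c ⬝ᵥ x` on Euclidean space. -/
noncomputable def dotCLM {d : ℕ} (c : Fin d → ℝ) : EuclideanSpace ℝ (Fin d) →L[ℝ] ℝ :=
  ∑ i, c i • EuclideanSpace.proj i

theorem dotCLM_apply {d : ℕ} (c : Fin d → ℝ) (x : EuclideanSpace ℝ (Fin d)) :
    dotCLM c x = ∑ i, c i * x i := by
  simp [dotCLM]

theorem dotProduct_sub_eq {d : ℕ} (c : Fin d → ℝ) (x y : EuclideanSpace ℝ (Fin d)) :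
    (c ⬝ᵥ fun k => x k - y k) = dotCLM c x - dotCLM c y := by
  simp only [dotCLM_apply, dotProduct, mul_sub, Finset.sum_sub_distrib]

theorem integral_mul_le_of_sq_le {Ω : Type*} [MeasurableSpace Ω] {P : Measure Ω} {f g : Ω → ℝ}
    (hf : MemLp f 2 P) (hg : MemLp g 2 P) {α β : ℝ} (hα : 0 ≤ α) (hβ : 0 ≤ β)
    (hfα : ∫ x, f x ^ 2 ∂P ≤ α ^ 2) (hgβ : ∫ x, g x ^ 2 ∂P ≤ β ^ 2) :
    ∫ x, f x * g x ∂P ≤ α * β := by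
  have hfg : Integrable (fun x => f x * g x) P := hf.integrable_mul hg
  have hd : discrim (∫ x, f x ^ 2 ∂P) (2 * ∫ x, f x * g x ∂P) (∫ x, g x ^ 2 ∂P) ≤ 0 := by
    refine discrim_le_zero fun t => ?_
    have e : ∫ x, (t * f x + g x) ^ 2 ∂P = (∫ x, f x ^ 2 ∂P) * (t * t)
        + 2 * (∫ x, f x * g x ∂P) * t + ∫ x, g x ^ 2 ∂P := by
      have e1 : ∀ x, (t * f x + g x) ^ 2 = (t * t) * f x ^ 2 + 2 * t * (f x * g x) + g x ^ 2 :=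
        fun x => by ring
      simp only [e1]
      have i1 : Integrable (fun x => t * t * f x ^ 2) P := hf.integrable_sq.const_mul _
      have i2 : Integrable (fun x => 2 * t * (f x * g x)) P := hfg.const_mul _
      have i12 : Integrable (fun x => t * t * f x ^ 2 + 2 * t * (f x * g x)) P := i1.add i2
      rw [integral_add i12 hg.integrable_sq, integral_add i1 i2, integral_const_mul,
        integral_const_mul]
      ring
    rw [← e]
    exact integral_nonneg fun x => sq_nonneg _
  have h1 : 0 ≤ ∫ x, g x ^ 2 ∂P := integral_nonneg fun x => sq_nonneg _
  have h2 : (∫ x, f x ^ 2 ∂P) * (∫ x, g x ^ 2 ∂P) ≤ α ^ 2 * β ^ 2 :=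
    mul_le_mul hfα hgβ h1 (sq_nonneg α)
  rw [discrim] at hd
  refine abs_le_of_sq_le_sq' (by nlinarith) (mul_nonneg hα hβ) |>.2

theorem IsLogConcaveDensity.memLp_sq {d : ℕ} {p : EuclideanSpace ℝ (Fin d) → ℝ}
    (hp : IsLogConcaveDensity p) (c : Fin d → ℝ) (y : EuclideanSpace ℝ (Fin d)) :
    MemLp (fun x : EuclideanSpace ℝ (Fin d) => (c ⬝ᵥ fun k => x k - y k) ^ 2) 2
      (densityMeasure p) := by
  simp only [dotProduct_sub_eq]
  rw [memLp_two_iff_integrable_sq (Continuous.aestronglyMeasurable (by fun_prop))]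
  simp only [← pow_mul]
  exact (hp.integrable_pow_four _ _).1

theorem IsLogConcaveDensity.memLp_two {d : ℕ} {p : EuclideanSpace ℝ (Fin d) → ℝ}
    (hp : IsLogConcaveDensity p) (c : Fin d → ℝ) (y : EuclideanSpace ℝ (Fin d)) :
    MemLp (fun x : EuclideanSpace ℝ (Fin d) => c ⬝ᵥ fun k => x k - y k) 2
      (densityMeasure p) := by
  have := hp.isProbabilityMeasure
  have h := (hp.memLp_sq c y).integrable (by norm_num)
  simp only [dotProduct_sub_eq] at h ⊢
  exact (memLp_two_iff_integrable_sq (Continuous.aestronglyMeasurable (by fun_prop))).2 h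

theorem IsLogConcaveDensity.memLp_two_coord {d : ℕ} {p : EuclideanSpace ℝ (Fin d) → ℝ}
    (hp : IsLogConcaveDensity p) (i : Fin d) (y : EuclideanSpace ℝ (Fin d)) :
    MemLp (fun x : EuclideanSpace ℝ (Fin d) => x i - y i) 2 (densityMeasure p) := by
  simpa using hp.memLp_two (Pi.single i 1) y

theorem IsLogConcaveDensity.integrable_id {d : ℕ} {p : EuclideanSpace ℝ (Fin d) → ℝ}
    (hp : IsLogConcaveDensity p) :
    Integrable (fun x : EuclideanSpace ℝ (Fin d) => x) (densityMeasure p) := by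
  have := hp.isProbabilityMeasure
  have h : ∀ x : EuclideanSpace ℝ (Fin d),
      x = ∑ i, (x i - (0 : EuclideanSpace ℝ (Fin d)) i) • EuclideanSpace.basisFun (Fin d) ℝ i := by
    intro x
    simpa using ((EuclideanSpace.basisFun (Fin d) ℝ).sum_repr x).symm
  have h2 : Integrable (fun x : EuclideanSpace ℝ (Fin d) => ∑ i,
      (x i - (0 : EuclideanSpace ℝ (Fin d)) i) • EuclideanSpace.basisFun (Fin d) ℝ i)
      (densityMeasure p) :=
    integrable_finsetSum _ fun i _ =>
      ((hp.memLp_two_coord i 0).integrable (by norm_num)).smul_const _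
  exact h2.congr (ae_of_all _ fun x => (h x).symm)

theorem IsLogConcaveDensity.integral_dotProduct_eq_zero {d : ℕ}
    {p : EuclideanSpace ℝ (Fin d) → ℝ} (hp : IsLogConcaveDensity p) (c : Fin d → ℝ) :
    ∫ x, (dotCLM c x - dotCLM c (densMean p)) ∂(densityMeasure p) = 0 := by
  have := hp.isProbabilityMeasure
  have hm : densMean p = ∫ x, x ∂(densityMeasure p) := by
    rw [hp.integral_densityMeasure, densMean]
  rw [integral_sub ((dotCLM c).integrable_comp hp.integrable_id) (integrable_const _),
    (dotCLM c).integral_comp_comm hp.integrable_id, ← hm]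
  simp

theorem IsLogConcaveDensity.integral_dotProduct_sq {d : ℕ}
    {p : EuclideanSpace ℝ (Fin d) → ℝ} (hp : IsLogConcaveDensity p) (c : Fin d → ℝ) :
    ∫ x, (c ⬝ᵥ fun k => x k - densMean p k) ^ 2 ∂(densityMeasure p)
      = c ⬝ᵥ (covMatrix p).mulVec c := by
  have hcov : ∀ i j, covMatrix p i j = ∫ x : EuclideanSpace ℝ (Fin d),
      (x i - densMean p i) * (x j - densMean p j) ∂(densityMeasure p) := by
    intro i j
    rw [hp.integral_densityMeasure]
    rfl
  have hint : ∀ i j, Integrable (fun x : EuclideanSpace ℝ (Fin d) =>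
      (x i - densMean p i) * (x j - densMean p j)) (densityMeasure p) := fun i j =>
    (hp.memLp_two_coord i _).integrable_mul (hp.memLp_two_coord j _)
  have hexp : ∀ x : EuclideanSpace ℝ (Fin d), (c ⬝ᵥ fun k => x k - densMean p k) ^ 2
      = ∑ i, ∑ j, c i * c j * ((x i - densMean p i) * (x j - densMean p j)) := by
    intro x
    rw [sq, dotProduct, Finset.sum_mul_sum]
    refine Finset.sum_congr rfl fun i _ => Finset.sum_congr rfl fun j _ => by ring
  simp only [hexp]
  rw [integral_finsetSum _ fun i _ => integrable_finsetSum _ fun j _ => (hint i j).const_mul _]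
  simp only [dotProduct, mulVec, Finset.mul_sum]
  refine Finset.sum_congr rfl fun i _ => ?_
  rw [integral_finsetSum _ fun j _ => (hint i j).const_mul _]
  refine Finset.sum_congr rfl fun j _ => ?_
  rw [integral_const_mul, hcov]
  ring

theorem IsLogConcaveDensity.integral_dotProduct_pow_four_le {d : ℕ}
    {p : EuclideanSpace ℝ (Fin d) → ℝ} (hp : IsLogConcaveDensity p) (c : Fin d → ℝ) :
    ∫ x, ((c ⬝ᵥ fun k => x k - densMean p k) ^ 2) ^ 2 ∂(densityMeasure p)
      ≤ (6 * (c ⬝ᵥ (covMatrix p).mulVec c)) ^ 2 := by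
  have h := (hp.integrable_pow_four (dotCLM c) (dotCLM c (densMean p))).2
    (hp.integral_dotProduct_eq_zero c)
  rw [← hp.integral_dotProduct_sq c]
  simp only [dotProduct_sub_eq, ← pow_mul]
  calc _ ≤ _ := h
    _ = _ := by ring

theorem covMatrix_isHermitian {d : ℕ} (p : EuclideanSpace ℝ (Fin d) → ℝ) :
    (covMatrix p).IsHermitian := by
  ext i j
  simp only [conjTranspose_apply, star_trivial, covMatrix, of_apply]
  congr 1
  ext x
  ring

theorem matRpow_isHermitian {d : ℕ} (A : Matrix (Fin d) (Fin d) ℝ) (r : ℝ) :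
    (matRpow A r).IsHermitian := by
  unfold matRpow
  split_ifs with hA
  · exact isHermitian_mul_mul_conjTranspose _ (isHermitian_diagonal _)
  · exact isHermitian_zero

/-! ### Diagonalization and the drift bound -/

theorem Matrix.IsHermitian.exists_orthogonal_diagonal {n : Type*} [Fintype n] [DecidableEq n]
    {Q : Matrix n n ℝ} (hQ : Q.IsHermitian) :
    ∃ (U : Matrix n n ℝ) (l : n → ℝ), U * Uᵀ = 1 ∧ Uᵀ * U = 1 ∧ Q = U * diagonal l * Uᵀ := by
  have hs : star (hQ.eigenvectorUnitary : Matrix n n ℝ)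
      = (hQ.eigenvectorUnitary : Matrix n n ℝ)ᵀ := by
    ext i j
    simp [star_apply]
  refine ⟨hQ.eigenvectorUnitary, hQ.eigenvalues, ?_, ?_, ?_⟩
  · rw [← hs]
    exact Unitary.coe_mul_star_self _
  · rw [← hs]
    exact Unitary.coe_star_mul_self _
  · rw [← hs]
    conv_lhs => rw [hQ.spectral_theorem, Unitary.conjStarAlgAut_apply]
    rfl

theorem Matrix.dotProduct_mul_diagonal_mul_transpose_mulVec {n : Type*} [Fintype n]
    [DecidableEq n] (M : Matrix n n ℝ) (e z : n → ℝ) :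
    z ⬝ᵥ (M * diagonal e * Mᵀ).mulVec z = ∑ i, e i * (Mᵀ i ⬝ᵥ z) ^ 2 := by
  rw [← mulVec_mulVec, ← mulVec_mulVec, dotProduct_mulVec, ← mulVec_transpose]
  simp only [dotProduct, mulVec_diagonal]
  refine Finset.sum_congr rfl fun i _ => ?_
  simp only [mulVec, dotProduct]
  ring

theorem Matrix.mul_diagonal_mul_transpose_pow {n : Type*} [Fintype n] [DecidableEq n]
    {U : Matrix n n ℝ} (hU : Uᵀ * U = 1) (l : n → ℝ) (k : ℕ) (hU' : U * Uᵀ = 1) :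
    (U * diagonal l * Uᵀ) ^ k = U * diagonal (fun i => l i ^ k) * Uᵀ := by
  induction k with
  | zero => simp [hU']
  | succ k ih =>
    rw [pow_succ, ih]
    calc _ = U * diagonal (fun i => l i ^ k) * (Uᵀ * U) * diagonal l * Uᵀ := by
          simp only [Matrix.mul_assoc]
      _ = U * (diagonal (fun i => l i ^ k) * diagonal l) * Uᵀ := by
          rw [hU, Matrix.mul_one, Matrix.mul_assoc U]
      _ = _ := by simp only [diagonal_mul_diagonal, pow_succ]

theorem le_const_mul_rpow_of_sq_le {T N : ℝ} (hT : 0 ≤ T) (hN : 0 ≤ N) {q : ℕ}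
    (h : N ^ 2 ≤ 6 * T * (T ^ (1 / (2 * (q : ℝ))) * N)) :
    N ≤ 16 * T ^ ((1 : ℝ) + 1 / (2 * (q : ℝ))) := by
  have hr : T ^ ((1 : ℝ) + 1 / (2 * (q : ℝ))) = T * T ^ (1 / (2 * (q : ℝ))) := by
    rw [Real.rpow_add_of_nonneg hT zero_le_one (by positivity), Real.rpow_one]
  have h0 : 0 ≤ T * T ^ (1 / (2 * (q : ℝ))) := mul_nonneg hT (Real.rpow_nonneg hT _)
  rw [hr]
  rcases hN.eq_or_lt with h1 | h1
  · rw [← h1]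
    positivity
  · have : N ≤ 6 * (T * T ^ (1 / (2 * (q : ℝ)))) := by
      refine le_of_mul_le_mul_right ?_ h1
      nlinarith
    linarith

/-- bound on the martingale drift vector `v_t`. -/
theorem drift_vector_bound {d : ℕ} (p : EuclideanSpace ℝ (Fin d) → ℝ)
    (hp : IsLogConcaveDensity p) (A : Matrix (Fin d) (Fin d) ℝ) (hA : A.PosDef)
    (Q : Matrix (Fin d) (Fin d) ℝ)
    (hQ : Q = matRpow A (-(1 : ℝ) / 2) * covMatrix p * matRpow A (-(1 : ℝ) / 2))
    (q : ℕ) (hq : 1 ≤ q) :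
    Real.sqrt (∑ i, (∫ x : EuclideanSpace ℝ (Fin d),
        p x * (((fun k => x k - densMean p k) ⬝ᵥ
            (matRpow A (-(1 : ℝ) / 2) * Q ^ (q - 1) * matRpow A (-(1 : ℝ) / 2)).mulVec
              (fun k => x k - densMean p k)) *
          (matRpow A (-(1 : ℝ) / 2)).mulVec (fun k => x k - densMean p k) i)) ^ 2)
      ≤ 16 * Matrix.trace (Q ^ q) ^ ((1 : ℝ) + 1 / (2 * (q : ℝ))) := by
  have hB := matRpow_isHermitian A (-(1 : ℝ) / 2)
  set B := matRpow A (-(1 : ℝ) / 2)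
  have hBt : Bᵀ = B := by
    ext i j
    simpa using hB.apply i j
  have hQh : Q.IsHermitian := by
    rw [hQ]
    have := isHermitian_mul_mul_conjTranspose B (covMatrix_isHermitian p)
    rwa [hB.eq] at this
  obtain ⟨U, l, hU, hU', hUQ⟩ := hQh.exists_orthogonal_diagonal
  have hpow : ∀ k, Q ^ k = U * diagonal (fun i => l i ^ k) * Uᵀ := fun k => by
    rw [hUQ, mul_diagonal_mul_transpose_pow hU' l k hU]
  set M := B * U with hM
  have hMt : Mᵀ = Uᵀ * B := by rw [hM, transpose_mul, hBt]
  have hquad : ∀ z : Fin d → ℝ, z ⬝ᵥ (B * Q ^ (q - 1) * B).mulVec z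
      = ∑ i, l i ^ (q - 1) * (Mᵀ i ⬝ᵥ z) ^ 2 := by
    intro z
    rw [← dotProduct_mul_diagonal_mul_transpose_mulVec M (fun i => l i ^ (q - 1)), hpow, hMt, hM]
    simp only [Matrix.mul_assoc]
  have hcl : ∀ i, Mᵀ i ⬝ᵥ (covMatrix p).mulVec (Mᵀ i) = l i := by
    intro i
    have e : Mᵀ * (covMatrix p * M) = diagonal l := by
      calc Mᵀ * (covMatrix p * M) = Uᵀ * (B * covMatrix p * B) * U := by
            rw [hMt, hM]
            simp only [Matrix.mul_assoc]
        _ = (Uᵀ * U) * diagonal l * (Uᵀ * U) := by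
            rw [← hQ, hUQ]
            simp only [Matrix.mul_assoc]
        _ = diagonal l := by rw [hU', Matrix.one_mul, Matrix.mul_one]
    have e2 := congrFun (congrFun e i) i
    rw [diagonal_apply_eq] at e2
    rw [← e2]
    rfl
  have hl : ∀ i, 0 ≤ l i := fun i => by
    rw [← hcl i, ← hp.integral_dotProduct_sq]
    exact integral_nonneg fun x => sq_nonneg _
  have hT : trace (Q ^ q) = ∑ i, l i ^ q := by
    rw [hpow, trace_mul_comm, ← Matrix.mul_assoc, hU', Matrix.one_mul, trace_diagonal]
  have hT0 : 0 ≤ trace (Q ^ q) := by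
    rw [hT]
    exact Finset.sum_nonneg fun i _ => pow_nonneg (hl i) q
  set T := trace (Q ^ q)
  simp only [hquad]
  set w : Fin d → ℝ := fun k => ∫ x : EuclideanSpace ℝ (Fin d),
    p x * ((∑ i, l i ^ (q - 1) * (Mᵀ i ⬝ᵥ fun k => x k - densMean p k) ^ 2) *
      B.mulVec (fun k => x k - densMean p k) k) with hw
  change √(∑ k, w k ^ 2) ≤ _
  have hint : ∀ (i : Fin d) (b : Fin d → ℝ), Integrable (fun x : EuclideanSpace ℝ (Fin d) =>
      (Mᵀ i ⬝ᵥ fun k => x k - densMean p k) ^ 2 * (b ⬝ᵥ fun k => x k - densMean p k))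
      (densityMeasure p) := fun i b => (hp.memLp_sq _ _).integrable_mul (hp.memLp_two _ _)
  have hwk : ∀ k, w k = ∑ i, l i ^ (q - 1) * ∫ x : EuclideanSpace ℝ (Fin d),
      (Mᵀ i ⬝ᵥ fun k => x k - densMean p k) ^ 2 * (B k ⬝ᵥ fun k => x k - densMean p k)
      ∂(densityMeasure p) := by
    intro k
    simp only [← integral_const_mul]
    rw [← integral_finsetSum _ fun i _ => (hint i (B k)).const_mul _,
      hp.integral_densityMeasure]
    simp only [hw, smul_eq_mul, Finset.sum_mul, mul_assoc]
    rfl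
  have hsum : ∑ k, w k ^ 2 = ∑ i, l i ^ (q - 1) * ∫ x : EuclideanSpace ℝ (Fin d),
      (Mᵀ i ⬝ᵥ fun k => x k - densMean p k) ^ 2 *
        (B.mulVec w ⬝ᵥ fun k => x k - densMean p k) ∂(densityMeasure p) := by
    have e : ∀ z : Fin d → ℝ, B.mulVec w ⬝ᵥ z = ∑ k, w k * (B k ⬝ᵥ z) := by
      intro z
      rw [dotProduct_comm, dotProduct_mulVec, ← mulVec_transpose, hBt, dotProduct_comm]
      rfl
    have e2 : ∀ i, ∫ x : EuclideanSpace ℝ (Fin d),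
        (Mᵀ i ⬝ᵥ fun k => x k - densMean p k) ^ 2 *
          (B.mulVec w ⬝ᵥ fun k => x k - densMean p k) ∂(densityMeasure p)
        = ∑ k, w k * ∫ x : EuclideanSpace ℝ (Fin d),
          (Mᵀ i ⬝ᵥ fun k => x k - densMean p k) ^ 2 * (B k ⬝ᵥ fun k => x k - densMean p k)
          ∂(densityMeasure p) := by
      intro i
      simp only [← integral_const_mul]
      rw [← integral_finsetSum _ fun k _ => (hint i (B k)).const_mul _]
      simp only [e, Finset.mul_sum]
      congr! 3
      ring
    simp only [e2, Finset.mul_sum]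
    rw [Finset.sum_comm]
    refine Finset.sum_congr rfl fun k _ => ?_
    rw [sq]
    nth_rewrite 2 [hwk k]
    rw [Finset.mul_sum]
    exact Finset.sum_congr rfl fun i _ => by ring
  set N := √(∑ k, w k ^ 2)
  have hN0 : 0 ≤ N := Real.sqrt_nonneg _
  have hN2 : N ^ 2 = ∑ k, w k ^ 2 := Real.sq_sqrt (Finset.sum_nonneg fun k _ => sq_nonneg _)
  have hq0 : (q : ℝ) ≠ 0 := by positivity
  have hβ0 : 0 ≤ T ^ (1 / (2 * (q : ℝ))) := Real.rpow_nonneg hT0 _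
  have hlT : ∀ i, l i ≤ (T ^ (1 / (2 * (q : ℝ)))) ^ 2 := by
    intro i
    refine le_of_pow_le_pow_left₀ (n := q) (by omega) (by positivity) ?_
    have : ((T ^ (1 / (2 * (q : ℝ)))) ^ 2) ^ q = T := by
      rw [← pow_mul, ← Real.rpow_natCast, ← Real.rpow_mul hT0]
      push_cast
      rw [one_div_mul_cancel (by positivity), Real.rpow_one]
    rw [this, hT]
    exact Finset.single_le_sum (f := fun i => l i ^ q) (fun j _ => pow_nonneg (hl j) q)
      (Finset.mem_univ i)
  have hUw : ∑ i, (Uᵀ i ⬝ᵥ w) ^ 2 = N ^ 2 := by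
    have := dotProduct_mul_diagonal_mul_transpose_mulVec U (fun _ => 1) w
    rw [diagonal_one, Matrix.mul_one, hU, one_mulVec] at this
    simp only [one_mul] at this
    rw [← this, hN2, dotProduct]
    simp only [sq]
  have hvar : ∫ x : EuclideanSpace ℝ (Fin d), (B.mulVec w ⬝ᵥ fun k => x k - densMean p k) ^ 2
      ∂(densityMeasure p) ≤ (T ^ (1 / (2 * (q : ℝ))) * N) ^ 2 := by
    have e : B.mulVec w ⬝ᵥ (covMatrix p).mulVec (B.mulVec w) = w ⬝ᵥ Q.mulVec w := by
      rw [hQ, ← mulVec_mulVec, ← mulVec_mulVec, dotProduct_mulVec w, ← mulVec_transpose, hBt]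
    rw [hp.integral_dotProduct_sq, e, hUQ, dotProduct_mul_diagonal_mul_transpose_mulVec, mul_pow,
      ← hUw, Finset.mul_sum]
    exact Finset.sum_le_sum fun i _ => mul_le_mul_of_nonneg_right (hlT i) (sq_nonneg _)
  refine le_const_mul_rpow_of_sq_le hT0 hN0 ?_
  rw [hN2, hsum, hT, Finset.mul_sum, Finset.sum_mul, ← hT]
  refine Finset.sum_le_sum fun i _ => ?_
  have h4 := hp.integral_dotProduct_pow_four_le (Mᵀ i)
  rw [hcl i] at h4
  have := integral_mul_le_of_sq_le (hp.memLp_sq (Mᵀ i) (densMean p))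
    (hp.memLp_two (B.mulVec w) (densMean p)) (mul_nonneg (by norm_num) (hl i))
    (mul_nonneg hβ0 hN0) h4 hvar
  calc _ ≤ l i ^ (q - 1) * (6 * l i * (T ^ (1 / (2 * (q : ℝ))) * N)) :=
        mul_le_mul_of_nonneg_left this (pow_nonneg (hl i) _)
    _ = 6 * (l i ^ (q - 1) * l i) * (T ^ (1 / (2 * (q : ℝ))) * N) := by ring
    _ = _ := by rw [← pow_succ, Nat.sub_add_cancel hq]
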